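/- Let ω = (2−φ, 1) and β ∈ [0,1]. If n = (n₁,n₂) ∈ ℤ², g ∈ Γ₀, and α ∈ [0,1] satisfy βω + n = g + αω, then ⟨(n₁,n₂), (15−6φ, −6)⟩ = 4(α − β)((2−φ)² + 1); in particular |(15−6φ)n₁ − 6n₂| ≤ 4((2−φ)² + 1). -/

import Mathlib

/-!
Statement 15: Let ω = (2−φ, 1) and β ∈ [0,1].  If n = (n₁,n₂) ∈ ℤ², g ∈ Γ₀ and α ∈ [0,1]
satisfy βω + n = g + αω, then ⟨(n₁,n₂), (15−6φ, −6)⟩ = 4(α−β)((2−φ)²+1); in particular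
|(15−6φ)n₁ − 6n₂| ≤ 4((2−φ)²+1).
-/

noncomputable section

namespace JeandelRao

/-- The golden ratio. -/
def φ : ℝ := (1 + Real.sqrt 5) / 2

/-- The lattice Γ₀ generated by (φ,0) and (1,φ+3). -/
def Γ₀ : AddSubgroup (ℝ × ℝ) := AddSubgroup.closure {(φ, 0), (1, φ + 3)}

theorem φ_irrational : Irrational φ := Real.goldenRatio_irrational

theorem φ_sq : φ ^ 2 = φ + 1 := Real.goldenRatio_sq

/-- `1` and `φ` are linearly independent over `ℤ`. -/
theorem eq_zero_of_int_add_int_mul_φ {x y : ℤ} (h : (x : ℝ) + y * φ = 0) : x = 0 ∧ y = 0 := by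
  have hy : y = 0 := by
    by_contra hy
    exact ((φ_irrational.intCast_mul hy).intCast_add x).ne_zero h
  subst hy
  simpa using h

theorem mem_Γ₀_iff {g : ℝ × ℝ} :
    g ∈ Γ₀ ↔ ∃ a b : ℤ, (a * φ + b, b * (φ + 3)) = g := by
  simp [Γ₀, AddSubgroup.mem_closure_pair, mul_add]

theorem slope_phi_sq_case (β α : ℝ) (hβ : β ∈ Set.Icc (0 : ℝ) 1) (hα : α ∈ Set.Icc (0 : ℝ) 1)
    (n : ℤ × ℤ) (g : ℝ × ℝ) (hg : g ∈ Γ₀)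
    (h : β • ((2 - φ, 1) : ℝ × ℝ) + ((n.1 : ℝ), (n.2 : ℝ))
          = g + α • ((2 - φ, 1) : ℝ × ℝ)) :
    (n.1 : ℝ) * (15 - 6 * φ) + (n.2 : ℝ) * (-6) = 4 * (α - β) * ((2 - φ) ^ 2 + 1) ∧
      |(15 - 6 * φ) * (n.1 : ℝ) - 6 * (n.2 : ℝ)| ≤ 4 * ((2 - φ) ^ 2 + 1) := by
  obtain ⟨a, b, rfl⟩ := mem_Γ₀_iff.1 hg
  obtain ⟨h₁, h₂⟩ := Prod.ext_iff.1 h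
  simp only [Prod.fst_add, Prod.snd_add, Prod.smul_fst, Prod.smul_snd, smul_eq_mul,
    mul_one] at h₁ h₂
  have hα' : α - β = n.2 - b * (φ + 3) := by linarith
  have hn : n.1 - 2 * n.2 + 4 * b = 0 ∧ n.2 - a - 2 * b = 0 := by
    apply eq_zero_of_int_add_int_mul_φ
    push_cast
    linear_combination h₁ + (φ - 2) * h₂ + b * φ_sq
  have hn₁ : (n.1 : ℝ) = 2 * n.2 - 4 * b := by
    exact_mod_cast (by linarith [hn.1] : n.1 = 2 * n.2 - 4 * b)
  have key : (n.1 : ℝ) * (15 - 6 * φ) + (n.2 : ℝ) * (-6)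
      = 4 * (α - β) * ((2 - φ) ^ 2 + 1) := by
    rw [hα', hn₁]
    linear_combination (-4 * (n.2 - b * (φ + 3)) - 12 * b) * φ_sq
  refine ⟨key, ?_⟩
  have hαβ : |α - β| ≤ 1 := abs_le.2 ⟨by linarith [hα.1, hβ.2], by linarith [hα.2, hβ.1]⟩
  have hpos : 0 ≤ 4 * ((2 - φ) ^ 2 + 1) := by positivity
  calc |(15 - 6 * φ) * (n.1 : ℝ) - 6 * (n.2 : ℝ)|
      = |(α - β) * (4 * ((2 - φ) ^ 2 + 1))| := by congr 1; linear_combination key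
    _ = |α - β| * (4 * ((2 - φ) ^ 2 + 1)) := by rw [abs_mul, abs_of_nonneg hpos]
    _ ≤ 4 * ((2 - φ) ^ 2 + 1) := mul_le_of_le_one_left hpos hαβ

end JeandelRao
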